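/- Let T be an empty lattice tetrahedron contained in a lattice parallelepiped P ⊂ ℝ^3. Then T can be covered by unimodular tetrahedra contained in P; that is, there is a collection of unimodular tetrahedra, each contained in P, whose union contains T. -/

import Mathlib

open scoped Pointwise

noncomputable section

/-- The real point corresponding to an integer point of `ℤ³`. -/
def toR3 (v : Fin 3 → ℤ) : Fin 3 → ℝ := fun i => (v i : ℝ)

/-- A unimodular tetrahedron: the convex hull of lattice points `v0, v1, v2, v3`
such that `v1 - v0, v2 - v0, v3 - v0` form a `ℤ`-basis of `ℤ³`. -/
def IsUnimodularTet (S : Set (Fin 3 → ℝ)) : Prop :=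
  ∃ v : Fin 4 → Fin 3 → ℤ,
    S = convexHull ℝ {toR3 (v 0), toR3 (v 1), toR3 (v 2), toR3 (v 3)} ∧
    (Matrix.of ![v 1 - v 0, v 2 - v 0, v 3 - v 0]).det ∈ ({1, -1} : Set ℤ)

/-- An empty lattice tetrahedron: four affinely independent lattice points whose
convex hull contains no lattice points other than its vertices. -/
def EmptyLatticeTet (p : Fin 4 → Fin 3 → ℤ) : Prop :=
  AffineIndependent ℝ (fun i => toR3 (p i)) ∧
  ∀ z : Fin 3 → ℤ,
    toR3 z ∈ convexHull ℝ (Set.range fun i => toR3 (p i)) → ∃ i, z = p i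

/-- The lattice parallelepiped `{v + λ₁a₁ + λ₂a₂ + λ₃a₃ : λᵢ ∈ [0,1]}`. -/
def Parallelepiped3 (v a₁ a₂ a₃ : Fin 3 → ℤ) : Set (Fin 3 → ℝ) :=
  {x | ∃ l₁ l₂ l₃ : ℝ, l₁ ∈ Set.Icc (0:ℝ) 1 ∧ l₂ ∈ Set.Icc (0:ℝ) 1 ∧
    l₃ ∈ Set.Icc (0:ℝ) 1 ∧
    x = toR3 v + l₁ • toR3 a₁ + l₂ • toR3 a₂ + l₃ • toR3 a₃}

/-- Homogenized vertex matrix. -/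
def homMat (p : Fin 4 → Fin 3 → ℤ) : Matrix (Fin 4) (Fin 4) ℤ :=
  Matrix.of fun i => ![1, p i 0, p i 1, p i 2]

lemma homMat_det (p : Fin 4 → Fin 3 → ℤ) :
    (homMat p).det = (Matrix.of ![p 1 - p 0, p 2 - p 0, p 3 - p 0]).det := by
  rw [Matrix.det_succ_row_zero, Matrix.det_fin_three]
  simp only [Fin.sum_univ_four, Matrix.det_fin_three]
  simp [homMat, Matrix.submatrix, Fin.succAbove, Fin.lt_def]
  ring

/-- Vectors whose combination of the rows of `A` is integral. -/
def latGp (A : Matrix (Fin 4) (Fin 4) ℤ) : AddSubgroup (Fin 4 → ℝ) where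
  carrier := {x | ∃ z : Fin 4 → ℤ, ∀ j, ∑ i, x i * (A i j : ℝ) = z j}
  zero_mem' := ⟨0, by simp⟩
  add_mem' := by
    rintro x y ⟨z, hz⟩ ⟨w, hw⟩
    exact ⟨z + w, fun j => by simp [add_mul, Finset.sum_add_distrib, hz, hw]⟩
  neg_mem' := by
    rintro x ⟨z, hz⟩
    exact ⟨-z, fun j => by simp [hz]⟩

lemma latGp_int (A : Matrix (Fin 4) (Fin 4) ℤ) (n : Fin 4 → ℤ) :
    (fun i => (n i : ℝ)) ∈ latGp A :=
  ⟨fun j => ∑ i, n i * A i j, fun j => by push_cast; rfl⟩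

lemma latGp_sum (p : Fin 4 → Fin 3 → ℤ) (x : Fin 4 → ℝ) (hx : x ∈ latGp (homMat p)) :
    ∃ s : ℤ, ∑ i, x i = s := by
  obtain ⟨z, hz⟩ := hx
  refine ⟨z 0, ?_⟩
  rw [← hz 0]
  simp [homMat]

/-- discreteness -/
lemma latGp_discrete (A : Matrix (Fin 4) (Fin 4) ℤ) (x : Fin 4 → ℝ) (hx : x ∈ latGp A)
    (k : Fin 4) : ∃ m : ℤ, (A.det : ℝ) * x k = m := by
  obtain ⟨z, hz⟩ := hx
  have h1 : Matrix.vecMul x (A.map (Int.cast : ℤ → ℝ)) = fun j => (z j : ℝ) := by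
    ext j
    simp [Matrix.vecMul, dotProduct, hz]
  have h2 : Matrix.vecMul (Matrix.vecMul x (A.map (Int.cast : ℤ → ℝ)))
      (A.adjugate.map (Int.cast : ℤ → ℝ)) = (A.det : ℝ) • x := by
    have : (A.map (Int.cast : ℤ → ℝ)) * (A.adjugate.map (Int.cast : ℤ → ℝ))
        = (A.det : ℝ) • (1 : Matrix (Fin 4) (Fin 4) ℝ) := by
      have h := congrArg (fun M : Matrix (Fin 4) (Fin 4) ℤ => M.map (Int.castRingHom ℝ))
        (Matrix.mul_adjugate A)
      simp only [Matrix.map_mul] at h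
      refine h.trans ?_
      ext i j
      simp only [Matrix.map_apply, Matrix.smul_apply, Matrix.one_apply, smul_eq_mul,
        Int.coe_castRingHom]
      split_ifs <;> simp
    rw [Matrix.vecMul_vecMul, this, Matrix.vecMul_smul, Matrix.vecMul_one]
  refine ⟨∑ j, z j * A.adjugate j k, ?_⟩
  have h3 := congrFun h2 k
  rw [h1] at h3
  simp only [Matrix.vecMul, dotProduct, Matrix.map_apply, Pi.smul_apply, smul_eq_mul] at h3
  rw [← h3]
  push_cast
  rfl

/-- nonintegral elements exist unless unimodular -/
lemma latGp_nonint (A : Matrix (Fin 4) (Fin 4) ℤ) (h0 : A.det ≠ 0)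
    (h1 : A.det.natAbs ≠ 1) :
    ∃ x ∈ latGp A, ¬ ∃ n : Fin 4 → ℤ, ∀ i, x i = n i := by
  by_contra hcon
  push Not at hcon
  have hdet : IsUnit (A.map (Int.cast : ℤ → ℝ)).det := by
    have : (A.map (Int.cast : ℤ → ℝ)).det = (A.det : ℝ) := by
      exact (RingHom.map_det (Int.castRingHom ℝ) _).symm
    rw [this]
    exact isUnit_iff_ne_zero.2 (by exact_mod_cast h0)
  have hinv := Matrix.nonsing_inv_mul _ hdet
  have hrow : ∀ r, ∃ n : Fin 4 → ℤ, ∀ i, (A.map (Int.cast : ℤ → ℝ))⁻¹ r i = n i := by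
    intro r
    refine hcon _ ⟨fun j => if r = j then 1 else 0, fun j => ?_⟩
    have := congrFun (congrFun hinv r) j
    rw [Matrix.mul_apply] at this
    simp only [Matrix.map_apply, Matrix.one_apply] at this
    rw [this]
    by_cases hrj : r = j <;> simp [hrj]
  choose N hN using hrow
  have hNA : (Matrix.of N) * A = 1 := by
    ext r j
    have := congrFun (congrFun hinv r) j
    rw [Matrix.mul_apply] at this ⊢
    simp only [Matrix.map_apply, Matrix.one_apply, hN] at this
    simp only [Matrix.of_apply, Matrix.one_apply]
    have h2 : ((∑ i, N r i * A i j : ℤ) : ℝ) = ((if r = j then 1 else 0 : ℤ) : ℝ) := by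
      push_cast
      exact this
    exact_mod_cast h2
  have := congrArg Matrix.det hNA
  rw [Matrix.det_mul, Matrix.det_one] at this
  exact h1 (Int.isUnit_iff_natAbs_eq.1 (IsUnit.of_mul_eq_one_right _ this))

lemma latGp_fract (A : Matrix (Fin 4) (Fin 4) ℤ) (x : Fin 4 → ℝ) (hx : x ∈ latGp A) :
    (fun i => Int.fract (x i)) ∈ latGp A := by
  have := (latGp A).sub_mem hx (latGp_int A fun i => ⌊x i⌋)
  convert this using 1
  ext i
  exact (Int.self_sub_floor (x i)).symm

/-- key existence lemma -/
lemma exists_pt (p : Fin 4 → Fin 3 → ℤ) (h0 : (homMat p).det ≠ 0)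
    (h1 : (homMat p).det.natAbs ≠ 1) (k : Fin 4) :
    ∃ x ∈ latGp (homMat p), ∑ i, x i = 1 ∧ (∀ i, x i < 1) ∧
      ((∀ i, 0 ≤ x i) ∨ (x k ≤ 0 ∧ ∀ i, i ≠ k → - x k ≤ x i)) := by
  by_cases hC : ∃ x ∈ latGp (homMat p), ∑ i, x i = 1 ∧ (∀ i, x i < 1) ∧ (∀ i, 0 ≤ x i)
  · obtain ⟨x, hx, hs, hl, hp⟩ := hC
    exact ⟨x, hx, hs, hl, Or.inl hp⟩
  push Not at hC
  have hC' : ∀ x ∈ latGp (homMat p), ∑ i, x i = 1 → (∀ i, x i < 1) → (∀ i, 0 ≤ x i) → False := by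
    intro x hx a b c
    obtain ⟨i, hi⟩ := hC x hx a b
    exact absurd (c i) (not_le.2 hi)
  -- complement trick
  have hcomp : ∀ x ∈ latGp (homMat p), (∀ i, 0 ≤ x i) → (∀ i, x i < 1) →
      ∑ i, (if x i = 0 then (0:ℝ) else 1 - x i) = 1 → False := by
    intro x hx hx0 hx1 hs
    refine hC' (fun i => if x i = 0 then (0:ℝ) else 1 - x i) ?_ hs ?_ ?_
    · have := (latGp (homMat p)).sub_mem
        (latGp_int (homMat p) fun i => if x i = 0 then 0 else 1) hx
      convert this using 1
      ext i
      by_cases h : x i = 0 <;> simp [h]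
    · intro i
      have := hx0 i
      by_cases h : x i = 0
      · simp [h]
      · have : 0 < x i := lt_of_le_of_ne this (Ne.symm h)
        simp only [h, if_false]; linarith
    · intro i
      have := hx1 i
      split_ifs <;> linarith
  -- E
  have hE0 : ∀ c ∈ latGp (homMat p), (∀ i, 0 ≤ c i) → (∀ i, c i < 1) → (∃ i, c i = 0) →
      ∀ i, c i = 0 := by
    intro c hc hc0 hc1 hex
    obtain ⟨s, hs⟩ := latGp_sum p c hc
    have hsn := Finset.sum_nonneg (s := Finset.univ) (f := c) (fun i _ => hc0 i)
    rw [hs] at hsn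
    have hs3 : (s : ℝ) < 3 := by
      rw [← hs, Fin.sum_univ_four]
      obtain ⟨i, hi⟩ := hex
      have a0 := hc1 0; have a1 := hc1 1; have a2 := hc1 2; have a3 := hc1 3
      fin_cases i <;> simp at hi <;> linarith
    have hsn' : 0 ≤ s := by exact_mod_cast hsn
    have hs3' : s < 3 := by exact_mod_cast hs3
    have hcases : s = 0 ∨ s = 1 ∨ s = 2 := by omega
    rcases hcases with h | h | h
    · rw [h] at hs
      intro i
      refine (Finset.sum_eq_zero_iff_of_nonneg (s := Finset.univ) (fun i _ => hc0 i)).1 ?_ i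
        (Finset.mem_univ _)
      rw [hs]; simp
    · exact (hC' c hc (by rw [hs, h]; simp) hc1 hc0).elim
    · exfalso
      refine hcomp c hc hc0 hc1 ?_
      rw [h, Fin.sum_univ_four] at hs
      push_cast at hs
      rw [Fin.sum_univ_four]
      obtain ⟨i, hi⟩ := hex
      have a0 := hc1 0; have a1 := hc1 1; have a2 := hc1 2; have a3 := hc1 3
      fin_cases i <;> simp at hi
      · rw [if_pos hi, if_neg, if_neg, if_neg] <;> first | linarith | (intro h; linarith)
      · rw [if_neg, if_pos hi, if_neg, if_neg] <;> first | linarith | (intro h; linarith)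
      · rw [if_neg, if_neg, if_pos hi, if_neg] <;> first | linarith | (intro h; linarith)
      · rw [if_neg, if_neg, if_neg, if_pos hi] <;> first | linarith | (intro h; linarith)
  have hE : ∀ x ∈ latGp (homMat p), (∃ i, ∃ n : ℤ, x i = n) → ∀ i, ∃ n : ℤ, x i = n := by
    intro x hx ⟨i, n, hn⟩ j
    have := hE0 _ (latGp_fract _ x hx) (fun i => Int.fract_nonneg _) (fun i => Int.fract_lt_one _)
      ⟨i, by simp [hn]⟩ j
    refine ⟨⌊x j⌋, ?_⟩
    have h2 := Int.floor_add_fract (x j)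
    linarith
  -- minimal positive k-coordinate
  have hq : (0:ℝ) < |((homMat p).det : ℝ)| := abs_pos.2 (by exact_mod_cast h0)
  have hmul : ∀ x ∈ latGp (homMat p), 0 < x k →
      ∃ m : ℕ, |((homMat p).det : ℝ)| * x k = m := by
    intro x hx hpos
    obtain ⟨m, hm⟩ := latGp_discrete _ x hx k
    refine ⟨m.natAbs, ?_⟩
    rw [Nat.cast_natAbs, Int.cast_abs, ← hm, abs_mul, abs_of_pos hpos]
  have hmin : ∃ x ∈ latGp (homMat p), 0 < x k ∧ ∀ y ∈ latGp (homMat p), 0 < y k → x k ≤ y k := by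
    have hex : ∃ m : ℕ, ∃ x ∈ latGp (homMat p), 0 < x k ∧ |((homMat p).det : ℝ)| * x k = m := by
      have h := latGp_int (homMat p) 1
      obtain ⟨m, hm⟩ := hmul _ h (by simp)
      exact ⟨m, _, h, by simp, hm⟩
    classical
    obtain ⟨x, hx, hx0, hxm⟩ := Nat.find_spec hex
    refine ⟨x, hx, hx0, fun y hy hy0 => ?_⟩
    obtain ⟨m, hm⟩ := hmul y hy hy0
    have h2 : Nat.find hex ≤ m := Nat.find_min' hex ⟨y, hy, hy0, hm⟩
    have h3 : ((Nat.find hex : ℕ) : ℝ) ≤ m := by exact_mod_cast h2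
    rw [← hxm, ← hm] at h3
    exact le_of_mul_le_mul_left h3 hq
  obtain ⟨x, hx, hx0, hxmin⟩ := hmin
  have hxlt : x k < 1 := by
    obtain ⟨z, hz, hzn⟩ := latGp_nonint _ h0 h1
    have hzk : ¬ ∃ n : ℤ, z k = n := by
      intro h
      apply hzn
      exact ⟨fun i => (hE z hz ⟨k, h⟩ i).choose, fun i => (hE z hz ⟨k, h⟩ i).choose_spec⟩
    have hf : 0 < Int.fract (z k) := by
      refine lt_of_le_of_ne (Int.fract_nonneg _) fun h => hzk ⟨⌊z k⌋, ?_⟩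
      have := Int.floor_add_fract (z k)
      linarith
    exact (hxmin _ (latGp_fract _ z hz) hf).trans_lt (Int.fract_lt_one _)
  -- N * x k = 1
  obtain ⟨N, hN⟩ : ∃ N : ℤ, (N : ℝ) * x k = 1 := by
    refine ⟨⌊1 / x k⌋, ?_⟩
    have hmem := (latGp (homMat p)).sub_mem (latGp_int (homMat p) 1)
      ((latGp (homMat p)).zsmul_mem hx ⌊1 / x k⌋)
    have ha := Int.floor_le (1 / x k)
    have hb := Int.lt_floor_add_one (1 / x k)
    rw [le_div_iff₀ hx0] at ha
    rw [div_lt_iff₀ hx0] at hb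
    by_contra hne
    have hlt := lt_of_le_of_ne ha hne
    have := hxmin _ hmem (by
      simp only [Pi.sub_apply, Pi.one_apply, zsmul_eq_mul, Pi.mul_apply, Pi.intCast_apply, Int.cast_one]
      linarith)
    simp only [Pi.sub_apply, Pi.one_apply, zsmul_eq_mul, Pi.mul_apply, Pi.intCast_apply, Int.cast_one] at this
    linarith
  have hNpos : (0:ℝ) < N := by
    by_contra h
    push Not at h
    nlinarith
  have hNint : ∀ i, ∃ n : ℤ, (N : ℝ) * x i = n := by
    have := hE _ ((latGp (homMat p)).zsmul_mem hx N) ⟨k, 1, by simpa using hN⟩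
    simpa using this
  have hxnon : ∀ i, ¬ ∃ n : ℤ, x i = n := by
    intro i hi
    obtain ⟨n, hn⟩ := hE x hx ⟨i, hi⟩ k
    rw [hn] at hx0 hxlt
    have a : 0 < n := by exact_mod_cast hx0
    have b : n < 1 := by exact_mod_cast hxlt
    omega
  obtain ⟨c, hc⟩ : ∃ c : Fin 4 → ℝ, c = fun i => Int.fract (-x i) := ⟨_, rfl⟩
  have hcm : c ∈ latGp (homMat p) := by
    rw [hc]
    exact latGp_fract _ _ ((latGp (homMat p)).neg_mem hx)
  have hck : c k = 1 - x k := by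
    rw [hc]
    refine Int.fract_eq_iff.2 ⟨by linarith, by linarith, -1, by push_cast; ring⟩
  have hc0 : ∀ i, 0 < c i := by
    intro i
    rw [hc]
    refine lt_of_le_of_ne (Int.fract_nonneg _) fun h => hxnon i ⟨-⌊-x i⌋, ?_⟩
    have := Int.floor_add_fract (-x i)
    push_cast
    linarith
  have hc1 : ∀ i, c i < 1 := by intro i; rw [hc]; exact Int.fract_lt_one _
  have hcx : ∀ i, x k ≤ c i := by
    intro i
    obtain ⟨n, hn⟩ := hNint i
    have h2 : (N : ℝ) * c i = ((-n - N * ⌊-x i⌋ : ℤ) : ℝ) := by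
      have := Int.floor_add_fract (-x i)
      rw [hc]
      push_cast
      rw [← hn]
      have h3 : Int.fract (-x i) = -x i - ⌊-x i⌋ := by linarith
      simp only [h3]
      ring
    have h3 : (0:ℝ) < (N : ℝ) * c i := mul_pos hNpos (hc0 i)
    rw [h2] at h3
    have h4 : (0:ℤ) < -n - N * ⌊-x i⌋ := by exact_mod_cast h3
    have h5 : (1:ℝ) ≤ (N : ℝ) * c i := by
      rw [h2]; exact_mod_cast h4
    rw [← hN] at h5
    exact le_of_mul_le_mul_left h5 hNpos
  obtain ⟨s, hs⟩ := latGp_sum p c hcm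
  have hs2 : ∑ i, c i = 2 := by
    have a : (0:ℝ) < s := by
      rw [← hs, Fin.sum_univ_four]
      linarith [hc0 0, hc0 1, hc0 2, hc0 3]
    have b : (s:ℝ) < 4 := by
      rw [← hs, Fin.sum_univ_four]
      linarith [hc1 0, hc1 1, hc1 2, hc1 3]
    have a' : 0 < s := by exact_mod_cast a
    have b' : s < 4 := by exact_mod_cast b
    have : s = 1 ∨ s = 2 ∨ s = 3 := by omega
    rcases this with h | h | h
    · exact (hC' c hcm (by rw [hs, h]; simp) hc1 (fun i => (hc0 i).le)).elim
    · rw [hs, h]; simp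
    · exfalso
      refine hcomp c hcm (fun i => (hc0 i).le) hc1 ?_
      simp only [(hc0 _).ne', if_false]
      rw [Finset.sum_sub_distrib, hs, h]
      norm_num
  refine ⟨fun i => c i - (if i = k then 1 else 0), ?_, ?_, ?_, Or.inr ⟨?_, ?_⟩⟩
  · have := (latGp (homMat p)).sub_mem hcm (latGp_int (homMat p) fun i => if i = k then 1 else 0)
    convert this using 1
    ext i
    simp
  · rw [Finset.sum_sub_distrib, hs2]
    simp; norm_num
  · intro i
    have := hc1 i
    show c i - (if i = k then 1 else 0) < 1
    split_ifs <;> linarith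
  · simp [(hc1 k).le]
  · intro i hi
    have := hcx i
    simp [hi]
    linarith

lemma P_convex (v a₁ a₂ a₃ : Fin 3 → ℤ) : Convex ℝ (Parallelepiped3 v a₁ a₂ a₃) := by
  rintro x ⟨l1, l2, l3, h1, h2, h3, rfl⟩ y ⟨m1, m2, m3, k1, k2, k3, rfl⟩ a b ha hb hab
  refine ⟨a * l1 + b * m1, a * l2 + b * m2, a * l3 + b * m3,
    convex_Icc 0 1 h1 k1 ha hb hab, convex_Icc 0 1 h2 k2 ha hb hab,
    convex_Icc 0 1 h3 k3 ha hb hab, ?_⟩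
  ext i
  simp
  linear_combination (toR3 v i) * hab

/-- corner lemma -/
lemma corner_exists (l : Fin 4 → Fin 3 → ℝ) (hl : ∀ i j, l i j ∈ Set.Icc (0:ℝ) 1) :
    ∃ k, ∀ j, (∑ i, l i j) / 2 - l k j ∈ Set.Icc (0:ℝ) 1 := by
  by_contra hcon
  push Not at hcon
  choose f hf using hcon
  have hinj : Function.Injective f := by
    intro k k' hkk
    have h1 := hf k
    have h2 := hf k'
    rw [← hkk] at h2
    generalize f k = j at h1 h2
    simp only [Set.mem_Icc, not_and_or, not_le, Fin.sum_univ_four] at h1 h2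
    obtain ⟨a0, b0⟩ := hl 0 j
    obtain ⟨a1, b1⟩ := hl 1 j
    obtain ⟨a2, b2⟩ := hl 2 j
    obtain ⟨a3, b3⟩ := hl 3 j
    by_contra hne
    fin_cases k <;> fin_cases k' <;> simp at h1 h2 hne <;>
      rcases h1 with h1 | h1 <;> rcases h2 with h2 | h2 <;> linarith
  have := Fintype.card_le_of_injective f hinj
  simp at this

lemma combo_mem (r : Fin 4 → ℝ) (hr : ∀ i, r i ∈ Set.Icc (0:ℝ) 1) (x : Fin 4 → ℝ)
    (hs : ∑ i, x i = 1) (k : Fin 4) (hk : (∑ i, r i) / 2 - r k ∈ Set.Icc (0:ℝ) 1)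
    (h : (∀ i, 0 ≤ x i) ∨ (x k ≤ 0 ∧ ∀ i, i ≠ k → - x k ≤ x i)) :
    ∑ i, x i * r i ∈ Set.Icc (0:ℝ) 1 := by
  have gen : ∀ (w q : Fin 4 → ℝ), (∀ i, 0 ≤ w i) → ∑ i, w i = 1 →
      (∀ i, q i ∈ Set.Icc (0:ℝ) 1) → ∑ i, w i * q i ∈ Set.Icc (0:ℝ) 1 := by
    intro w q hw hw1 hq
    exact (convex_Icc (0:ℝ) 1).sum_mem (fun i _ => hw i) hw1 (fun i _ => hq i)
  rcases h with h | ⟨h0, h⟩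
  · exact gen x r h hs hr
  · have := gen (fun i => if i = k then -2 * x k else x i + x k)
      (fun i => if i = k then (∑ i, r i) / 2 - r k else r i) ?_ ?_ ?_
    · convert this using 1
      fin_cases k <;> simp [Fin.sum_univ_four] <;> ring
    · intro i
      split_ifs with hi
      · linarith
      · linarith [h i hi]
    · rw [← hs]
      fin_cases k <;> simp [Fin.sum_univ_four] <;> ring
    · intro i
      split_ifs with hi
      · exact hk
      · exact hr i

lemma main_ind (v a₁ a₂ a₃ : Fin 3 → ℤ) (n : ℕ) : ∀ p : Fin 4 → Fin 3 → ℤ,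
    (homMat p).det.natAbs = n → n ≠ 0 → (∀ i, toR3 (p i) ∈ Parallelepiped3 v a₁ a₂ a₃) →
    ∀ y : Fin 4 → ℝ, (∀ i, 0 ≤ y i) → ∑ i, y i = 1 →
    ∃ S, IsUnimodularTet S ∧ S ⊆ Parallelepiped3 v a₁ a₂ a₃ ∧ ∑ i, y i • toR3 (p i) ∈ S := by
  induction n using Nat.strong_induction_on with
  | _ n ih =>
  intro p hn hn0 hP y hy0 hy1
  by_cases h1 : n = 1
  · refine ⟨convexHull ℝ {toR3 (p 0), toR3 (p 1), toR3 (p 2), toR3 (p 3)}, ⟨p, rfl, ?_⟩, ?_, ?_⟩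
    · rw [← homMat_det]
      rw [h1] at hn
      exact Int.natAbs_eq_iff.1 hn
    · refine convexHull_min ?_ (P_convex _ _ _ _)
      rintro z (rfl | rfl | rfl | rfl) <;> apply hP
    · refine (convex_convexHull ℝ _).sum_mem (fun i _ => hy0 i) hy1 fun i _ =>
        subset_convexHull ℝ _ ?_
      fin_cases i <;> simp
  have hP' := hP
  choose l1 l2 l3 hl1 hl2 hl3 hl using hP'
  obtain ⟨k, hk⟩ := corner_exists (fun i => ![l1 i, l2 i, l3 i]) (by
    intro i j
    fin_cases j
    · exact hl1 i
    · exact hl2 i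
    · exact hl3 i)
  have h0 : (homMat p).det ≠ 0 := by
    intro h; rw [h] at hn; exact hn0 hn.symm
  obtain ⟨x, ⟨z, hz⟩, hxs, hxlt, hx⟩ := exists_pt p h0 (by rw [hn]; exact h1) k
  obtain ⟨u, hu⟩ : ∃ u : Fin 3 → ℤ, u = fun j => z j.succ := ⟨_, rfl⟩
  have huR : toR3 u = ∑ i, x i • toR3 (p i) := by
    ext j
    simp only [toR3, hu, ← hz, homMat, Finset.sum_apply, Pi.smul_apply, smul_eq_mul]
    fin_cases j <;> simp
  have huP : toR3 u ∈ Parallelepiped3 v a₁ a₂ a₃ := by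
    refine ⟨∑ i, x i * l1 i, ∑ i, x i * l2 i, ∑ i, x i * l3 i,
      combo_mem l1 hl1 x hxs k (by simpa using hk 0) hx,
      combo_mem l2 hl2 x hxs k (by simpa using hk 1) hx,
      combo_mem l3 hl3 x hxs k (by simpa using hk 2) hx, ?_⟩
    rw [huR]
    ext j
    simp only [hl, Finset.sum_apply, Pi.smul_apply, Pi.add_apply, smul_eq_mul, Fin.sum_univ_four]
    rw [Fin.sum_univ_four] at hxs
    linear_combination (toR3 v j) * hxs
  -- choose minimizer
  obtain ⟨m, hm0, hm⟩ : ∃ m, 0 < x m ∧ ∀ i, 0 < x i → y m / x m ≤ y i / x i := by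
    have hne : (Finset.univ.filter fun i => 0 < x i).Nonempty := by
      by_contra hcon
      rw [Finset.not_nonempty_iff_eq_empty, Finset.filter_eq_empty_iff] at hcon
      have := Finset.sum_nonpos (s := Finset.univ) (f := x)
        (fun i hi => not_lt.1 (hcon hi))
      linarith
    obtain ⟨m, hm, hmin⟩ := Finset.exists_min_image _ (fun i => y i / x i) hne
    refine ⟨m, (Finset.mem_filter.1 hm).2, fun i hi => hmin i (by simp [hi])⟩
  set t := y m / x m with ht
  have ht0 : 0 ≤ t := div_nonneg (hy0 m) hm0.le
  have htm : y m = t * x m := by rw [ht]; field_simp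
  have hdet : (((homMat (Function.update p m u)).det : ℤ) : ℝ) = x m * (homMat p).det := by
    have h := Matrix.det_updateRow_sum ((homMat p).map (Int.cast : ℤ → ℝ)) m x
    have e1 : ((homMat p).map (Int.cast : ℤ → ℝ)).det = ((homMat p).det : ℝ) := by
      exact (RingHom.map_det (Int.castRingHom ℝ) _).symm
    have e2 : ((homMat (Function.update p m u)).map (Int.cast : ℤ → ℝ)).det
        = ((homMat (Function.update p m u)).det : ℝ) := by
      exact (RingHom.map_det (Int.castRingHom ℝ) _).symm
    rw [← e2, ← e1, ← smul_eq_mul, ← h]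
    congr 1
    ext i j
    by_cases him : i = m
    · subst him
      have huj : ∀ j, (u j : ℝ) = ∑ i, x i * (p i j : ℝ) := by
        intro j
        have := congrFun huR j
        simpa [toR3] using this
      fin_cases j <;> simp [homMat, huj, hxs]
    · simp [homMat, Matrix.updateRow_ne, him]
  have hq : (0:ℝ) < |((homMat p).det : ℝ)| := abs_pos.2 (by exact_mod_cast h0)
  have hnR : |((homMat p).det : ℝ)| = n := by
    rw [← hn, Nat.cast_natAbs, Int.cast_abs]
  have hdn : (((homMat (Function.update p m u)).det.natAbs : ℕ) : ℝ) = x m * n := by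
    rw [Nat.cast_natAbs, Int.cast_abs, hdet, abs_mul, abs_of_pos hm0, hnR]
  rw [hnR] at hq
  have hlt : (homMat (Function.update p m u)).det.natAbs < n := by
    have : (((homMat (Function.update p m u)).det.natAbs : ℕ) : ℝ) < n := by
      rw [hdn]; nlinarith [hxlt m]
    exact_mod_cast this
  have hne : (homMat (Function.update p m u)).det.natAbs ≠ 0 := by
    have : (0:ℝ) < (((homMat (Function.update p m u)).det.natAbs : ℕ) : ℝ) := by
      rw [hdn]; positivity
    have h' : 0 < (homMat (Function.update p m u)).det.natAbs := by exact_mod_cast this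
    omega
  obtain ⟨S, hS, hSP, hyS⟩ := ih _ hlt (Function.update p m u) rfl hne
    (by
      intro i
      by_cases him : i = m
      · subst him; simpa using huP
      · simpa [him] using hP i)
    (fun i => y i - t * x i + if i = m then t else 0)
    (by
      intro i
      by_cases him : i = m
      · subst him; simp; linarith
      · simp only [him, if_false, add_zero]
        by_cases hxi : 0 < x i
        · have := hm i hxi
          rw [le_div_iff₀ hxi] at this
          linarith
        · nlinarith [hy0 i])
    (by
      rw [Finset.sum_add_distrib, Finset.sum_sub_distrib, ← Finset.mul_sum, hy1, hxs]
      simp)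
  refine ⟨S, hS, hSP, ?_⟩
  convert hyS using 1
  have hterm : ∀ i, (y i - t * x i + if i = m then t else 0) • toR3 (Function.update p m u i)
      = y i • toR3 (p i) - t • (x i • toR3 (p i)) + (if i = m then t • toR3 u else 0) := by
    intro i
    by_cases him : i = m
    · subst him
      simp only [Function.update_self, if_true]
      rw [htm, smul_smul]
      simp
    · simp only [him, if_false, add_zero, ne_eq, not_false_eq_true, Function.update_of_ne]
      rw [sub_smul, smul_smul]
  rw [Finset.sum_congr rfl fun i _ => hterm i, Finset.sum_add_distrib, Finset.sum_sub_distrib,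
    ← Finset.smul_sum, ← huR]
  simp

lemma det_ne_of_affineIndependent (p : Fin 4 → Fin 3 → ℤ)
    (h : AffineIndependent ℝ (fun i => toR3 (p i))) : (homMat p).det ≠ 0 := by
  intro h0
  obtain ⟨w, hw, hw0⟩ := Matrix.exists_vecMul_eq_zero_iff.2 h0
  apply hw
  have hj : ∀ j, ∑ i, w i * homMat p i j = 0 := fun j => by
    simpa [Matrix.vecMul, dotProduct] using congrFun hw0 j
  have key := (affineIndependent_iff.1 h) Finset.univ (fun i => (w i : ℝ))
    (by
      have := hj 0
      simp [homMat] at this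
      exact_mod_cast this)
    (by
      ext j
      have e : ∀ j : Fin 3, ∑ i, w i * p i j = 0 := by
        intro j
        have := hj j.succ
        fin_cases j <;> simpa [homMat] using this
      have := e j
      simp only [Finset.sum_apply, Pi.smul_apply, smul_eq_mul, toR3, Pi.zero_apply]
      exact_mod_cast this)
  ext i
  have := key i (Finset.mem_univ _)
  exact_mod_cast this

/-- An empty lattice tetrahedron contained in a lattice parallelepiped `P` can
be covered by unimodular tetrahedra contained in `P`. -/
theorem empty_tet_in_parallelepiped_unimodular_cover
    (v a₁ a₂ a₃ : Fin 3 → ℤ)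
    (h : LinearIndependent ℝ ![toR3 a₁, toR3 a₂, toR3 a₃])
    (p : Fin 4 → Fin 3 → ℤ) (hEmpty : EmptyLatticeTet p)
    (hT : convexHull ℝ (Set.range fun i => toR3 (p i)) ⊆ Parallelepiped3 v a₁ a₂ a₃) :
    ∃ 𝒞 : Set (Set (Fin 3 → ℝ)),
      (∀ S ∈ 𝒞, IsUnimodularTet S ∧ S ⊆ Parallelepiped3 v a₁ a₂ a₃) ∧
      convexHull ℝ (Set.range fun i => toR3 (p i)) ⊆ ⋃₀ 𝒞 := by
  refine ⟨{S | IsUnimodularTet S ∧ S ⊆ Parallelepiped3 v a₁ a₂ a₃}, fun S hS => hS, ?_⟩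
  intro y hy
  have hdet := det_ne_of_affineIndependent p hEmpty.1
  have hP : ∀ i, toR3 (p i) ∈ Parallelepiped3 v a₁ a₂ a₃ := fun i =>
    hT (subset_convexHull ℝ _ ⟨i, rfl⟩)
  obtain ⟨w, hw0, hw1, hwy⟩ : ∃ w : Fin 4 → ℝ, (∀ i, 0 ≤ w i) ∧ ∑ i, w i = 1 ∧
      ∑ i, w i • toR3 (p i) = y := by
    refine convexHull_min (t := {y | ∃ w : Fin 4 → ℝ, (∀ i, 0 ≤ w i) ∧ ∑ i, w i = 1 ∧
      ∑ i, w i • toR3 (p i) = y}) ?_ ?_ hy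
    · rintro _ ⟨i, rfl⟩
      refine ⟨Pi.single i 1, fun j => ?_, by simp, by simp [Pi.single_apply]⟩
      by_cases hij : j = i <;> simp [Pi.single_apply, hij]
    · rintro _ ⟨w, a, b, rfl⟩ _ ⟨w', a', b', rfl⟩ c d hc hd hcd
      refine ⟨fun i => c * w i + d * w' i, fun i => ?_, ?_, ?_⟩
      · have := a i
        have := a' i
        positivity
      · rw [Finset.sum_add_distrib, ← Finset.mul_sum, ← Finset.mul_sum, b, b']
        linarith
      · simp only [add_smul, mul_smul, Finset.sum_add_distrib, Finset.smul_sum]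
  obtain ⟨S, h1, h2, h3⟩ := main_ind v a₁ a₂ a₃ _ p rfl (Int.natAbs_ne_zero.2 hdet) hP w hw0 hw1
  exact ⟨S, ⟨h1, h2⟩, hwy ▸ h3⟩
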